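/- Suppose Assumption A holds. Then there are positive constants δ, κ₀, and κ₁ such that for all (z,λ) with δ(z,λ) ≤ δ, the quantity η(z,λ) satisfies κ₀ δ(z,λ) ≤ η(z,λ) ≤ κ₁ δ(z,λ). -/

import Mathlib

open scoped RealInnerProductSpace
open Metric Set

noncomputable section

/-- Euclidean space ℝ^n. -/
abbrev En (n : ℕ) := EuclideanSpace ℝ (Fin n)

/-- The Lagrangian L(z,λ) = φ(z) + λᵀ g(z). -/
def Lagr {n m : ℕ} (φ : En n → ℝ) (g : Fin m → En n → ℝ) (z : En n) (l : En m) : ℝ :=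
  φ z + ∑ i, l i * g i z

/-- ∇_z L(z,λ). -/
def gradL {n m : ℕ} (φ : En n → ℝ) (g : Fin m → En n → ℝ) (l : En m) (z : En n) : En n :=
  gradient (fun z' => Lagr φ g z' l) z

/-- ∇²_{zz} L(z,λ), as a continuous linear map. -/
def hessL {n m : ℕ} (φ : En n → ℝ) (g : Fin m → En n → ℝ) (l : En m) (z : En n) :
    En n →L[ℝ] En n :=
  fderiv ℝ (gradL φ g l) z

/-- The KKT conditions at a point z with multiplier λ. -/
def KKTat {n m : ℕ} (φ : En n → ℝ) (g : Fin m → En n → ℝ) (z : En n) (l : En m) : Prop :=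
  gradL φ g l z = 0 ∧ (∀ i, g i z ≤ 0) ∧ (∀ i, 0 ≤ l i) ∧ ∑ i, l i * g i z = 0

/-- The set S_λ of optimal multipliers at z*. -/
def Slam {n m : ℕ} (φ : En n → ℝ) (g : Fin m → En n → ℝ) (zs : En n) : Set (En m) :=
  {l | KKTat φ g zs l}

/-- The active set B. -/
def ActB {n m : ℕ} (g : Fin m → En n → ℝ) (zs : En n) : Set (Fin m) := {i | g i zs = 0}

/-- Strongly active constraints B₊. -/
def Bplus {n m : ℕ} (φ : En n → ℝ) (g : Fin m → En n → ℝ) (zs : En n) : Set (Fin m) :=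
  {i | g i zs = 0 ∧ ∃ l ∈ Slam φ g zs, 0 < l i}

/-- Weakly active constraints B₀ = B \ B₊. -/
def Bzero {n m : ℕ} (φ : En n → ℝ) (g : Fin m → En n → ℝ) (zs : En n) : Set (Fin m) :=
  ActB g zs \ Bplus φ g zs

/-- Mangasarian–Fromovitz constraint qualification at z*. -/
def MFCQ {n m : ℕ} (g : Fin m → En n → ℝ) (zs : En n) : Prop :=
  ∃ y : En n, ∀ i ∈ ActB g zs, ⟪gradient (g i) zs, y⟫ < 0

/-- The second-order sufficient condition. -/
def SOC {n m : ℕ} (φ : En n → ℝ) (g : Fin m → En n → ℝ) (zs : En n) : Prop :=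
  ∃ σ : ℝ, 0 < σ ∧ ∀ l ∈ Slam φ g zs, ∀ w : En n,
    (∀ i ∈ Bplus φ g zs, ⟪gradient (g i) zs, w⟫ = 0) →
    (∀ i ∈ Bzero φ g zs, ⟪gradient (g i) zs, w⟫ ≤ 0) →
    σ * ‖w‖ ^ 2 ≤ ⟪w, hessL φ g l zs w⟫

/-- φ and g twice Lipschitz continuously differentiable near z*. -/
def Smooth2 {n m : ℕ} (φ : En n → ℝ) (g : Fin m → En n → ℝ) (zs : En n) : Prop :=
  ∃ U ∈ nhds zs, ContDiffOn ℝ 2 φ U ∧ (∀ i, ContDiffOn ℝ 2 (g i) U) ∧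
    ∃ K : NNReal, LipschitzOnWith K (fun z => fderiv ℝ (fderiv ℝ φ) z) U ∧
      ∀ i, LipschitzOnWith K (fun z => fderiv ℝ (fderiv ℝ (g i)) z) U

/-- Assumption A: smoothness, KKT, MFCQ and the second-order condition hold at z*. -/
def AssumpA {n m : ℕ} (φ : En n → ℝ) (g : Fin m → En n → ℝ) (zs : En n) : Prop :=
  Smooth2 φ g zs ∧ (∃ l : En m, KKTat φ g zs l) ∧ MFCQ g zs ∧ SOC φ g zs

/-- δ(z,λ) = dist((z,λ), S) where S = {z*} × S_λ (Euclidean product norm). -/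
def deltaP {n m : ℕ} (φ : En n → ℝ) (g : Fin m → En n → ℝ) (zs : En n)
    (z : En n) (l : En m) : ℝ :=
  Real.sqrt (‖z - zs‖ ^ 2 + (Metric.infDist l (Slam φ g zs)) ^ 2)

/-- η(z,λ) = ‖(∇_z L(z,λ), min(λ, −g(z)))‖. -/
def eta {n m : ℕ} (φ : En n → ℝ) (g : Fin m → En n → ℝ) (z : En n) (l : En m) : ℝ :=
  Real.sqrt (‖gradL φ g l z‖ ^ 2 + ∑ i, (min (l i) (-(g i z))) ^ 2)

/-- The estimated active set A(z,λ) = {i : g_i(z) ≥ −η(z,λ)^τ}. -/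
def Aest {n m : ℕ} (φ : En n → ℝ) (g : Fin m → En n → ℝ) (τ : ℝ) (z : En n) (l : En m) :
    Set (Fin m) :=
  {i | -(eta φ g z l) ^ τ ≤ g i z}

/-- Feasibility for the linear program LP(Â) (independent of Â): componentwise bounds on
∇φ(z) + Σ_i λ̃_i ∇g_i(z), nonnegativity on A(z,λ), and λ̃_i = 0 off A(z,λ). -/
def LPFeasible {n m : ℕ} (φ : En n → ℝ) (g : Fin m → En n → ℝ) (τ : ℝ)
    (z : En n) (l : En m) (lt : En m) : Prop :=
  (∀ j : Fin n, |(gradient φ z + ∑ i, lt i • gradient (g i) z) j| ≤ (eta φ g z l) ^ τ) ∧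
  (∀ i ∈ Aest φ g τ z l, 0 ≤ lt i) ∧ (∀ i ∉ Aest φ g τ z l, lt i = 0)

/-- The objective Σ_{i ∈ Â} λ̃_i of LP(Â). -/
def lpObj {m : ℕ} (Ah : Set (Fin m)) (lt : En m) : ℝ :=
  ∑ i, Ah.indicator (fun i => lt i) i

/-- λ̃ is an optimal solution of LP(Â). -/
def LPOptimal {n m : ℕ} (φ : En n → ℝ) (g : Fin m → En n → ℝ) (τ : ℝ)
    (z : En n) (l : En m) (Ah : Set (Fin m)) (lt : En m) : Prop :=
  LPFeasible φ g τ z l lt ∧ ∀ lt', LPFeasible φ g τ z l lt' → lpObj Ah lt' ≤ lpObj Ah lt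

/-- The initial working set Â_init of Procedure ID0. -/
def initSet {n m : ℕ} (φ : En n → ℝ) (g : Fin m → En n → ℝ) (τ th : ℝ)
    (z : En n) (l : En m) : Set (Fin m) :=
  Aest φ g τ z l \ {i | (eta φ g z l) ^ th ≤ l i}

/-- One pass of the repeat loop of Procedure ID0 that does not stop:
an optimal solution λ̃ of LP(Â) is chosen, C = {i ∈ Â : λ̃_i ≥ η^τ̂} is nonempty,
and the working set is updated to Â \ C. -/
def ID0Step {n m : ℕ} (φ : En n → ℝ) (g : Fin m → En n → ℝ) (τ th : ℝ)
    (z : En n) (l : En m) (Ah Ah' : Set (Fin m)) : Prop :=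
  ∃ lt, LPOptimal φ g τ z l Ah lt ∧
    {i | i ∈ Ah ∧ (eta φ g z l) ^ th ≤ lt i} ≠ ∅ ∧
    Ah' = Ah \ {i | i ∈ Ah ∧ (eta φ g z l) ^ th ≤ lt i}

/-- (A₀, A₊) is a possible output of Procedure ID0 on input (z,λ). -/
def ID0Out {n m : ℕ} (φ : En n → ℝ) (g : Fin m → En n → ℝ) (τ th : ℝ)
    (z : En n) (l : En m) (A0 Ap : Set (Fin m)) : Prop :=
  ∃ Ah : Set (Fin m),
    Relation.ReflTransGen (ID0Step φ g τ th z l) (initSet φ g τ th z l) Ah ∧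
    ((∃ lt, LPOptimal φ g τ z l Ah lt ∧
        {i | i ∈ Ah ∧ (eta φ g z l) ^ th ≤ lt i} = ∅ ∧
        A0 = Ah ∧ Ap = Aest φ g τ z l \ Ah) ∨
     (∃ lt, LPOptimal φ g τ z l Ah lt ∧
        {i | i ∈ Ah ∧ (eta φ g z l) ^ th ≤ lt i} ≠ ∅ ∧
        Ah \ {i | i ∈ Ah ∧ (eta φ g z l) ^ th ≤ lt i} = ∅ ∧
        A0 = ∅ ∧ Ap = Aest φ g τ z l))

/-- Feasibility for the linear program (intlam). -/
def IntFeasible {n m : ℕ} (φ : En n → ℝ) (g : Fin m → En n → ℝ) (τ : ℝ)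
    (z : En n) (l : En m) (Ap : Set (Fin m)) (t : ℝ) (lh : En m) : Prop :=
  (∀ i ∈ Ap, t ≤ lh i) ∧
  (∀ j : Fin n, |(gradient φ z + ∑ i, lh i • gradient (g i) z) j| ≤ (eta φ g z l) ^ τ) ∧
  (∀ i ∈ Ap, 0 ≤ lh i) ∧ (∀ i ∉ Ap, lh i = 0)

/-- (t̂, λ̂) is an optimal solution of (intlam). -/
def IntOptimal {n m : ℕ} (φ : En n → ℝ) (g : Fin m → En n → ℝ) (τ : ℝ)
    (z : En n) (l : En m) (Ap : Set (Fin m)) (t : ℝ) (lh : En m) : Prop :=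
  IntFeasible φ g τ z l Ap t lh ∧
  ∀ t' lh', IntFeasible φ g τ z l Ap t' lh' → t' ≤ t

/-- ε_λ = max_{λ* ∈ S_λ} min_{i ∈ B₊} λ*_i. -/
def epsLam {n m : ℕ} (φ : En n → ℝ) (g : Fin m → En n → ℝ) (zs : En n) : ℝ :=
  ⨆ l ∈ Slam φ g zs, ⨅ i ∈ Bplus φ g zs, l i

/-- S_λ^ν = {λ ∈ S_λ : min_{i∈B₊} λ_i ≥ ν ε_λ}. -/
def SlamNu {n m : ℕ} (φ : En n → ℝ) (g : Fin m → En n → ℝ) (zs : En n) (ν : ℝ) :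
    Set (En m) :=
  {l ∈ Slam φ g zs | ∀ i ∈ Bplus φ g zs, ν * epsLam φ g zs ≤ l i}

/-- (Δz, λ⁺) solves the stabilized SQP subproblem at (z,λ) with parameter μ. -/
def SSQPSol {n m : ℕ} (φ : En n → ℝ) (g : Fin m → En n → ℝ)
    (z : En n) (l : En m) (μ : ℝ) (dz : En n) (lp : En m) : Prop :=
  hessL φ g l z dz + gradient φ z + ∑ i, lp i • gradient (g i) z = 0 ∧
  (∀ i, 0 ≤ lp i) ∧
  (∀ i, g i z + ⟪gradient (g i) z, dz⟫ - μ * (lp i - l i) ≤ 0) ∧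
  ∑ i, lp i * (g i z + ⟪gradient (g i) z, dz⟫ - μ * (lp i - l i)) = 0

/-- Euclidean distance between primal-dual pairs. -/
def pdist {n m : ℕ} (p q : En n × En m) : ℝ :=
  Real.sqrt (‖p.1 - q.1‖ ^ 2 + ‖p.2 - q.2‖ ^ 2)

section ErrorBound

open Filter Topology

section Linearization

variable {n m : ℕ} {φ : En n → ℝ} {g : Fin m → En n → ℝ} {z zs : En n}

theorem ContDiffAt.hasFDerivAt_gradient {f : En n → ℝ} (hf : ContDiffAt ℝ 2 f z) :
    HasFDerivAt (gradient f) (fderiv ℝ (gradient f) z) z := by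
  have h : ContDiffAt ℝ 1 (fderiv ℝ f) z := hf.fderiv_right (by norm_num)
  have h2 : DifferentiableAt ℝ (fderiv ℝ f) z := h.differentiableAt (by norm_num)
  exact ((InnerProductSpace.toDual ℝ (En n)).symm.toContinuousLinearEquiv.differentiableAt.comp
    z h2).hasFDerivAt

theorem ContDiffAt.eventually_differentiableAt_of_two {f : En n → ℝ} (hf : ContDiffAt ℝ 2 f zs) :
    ∀ᶠ z in 𝓝 zs, DifferentiableAt ℝ f z :=
  (hf.eventually (by norm_num)).mono fun _ h => h.differentiableAt (by norm_num)

theorem gradL_eq (hφ : DifferentiableAt ℝ φ z) (hg : ∀ i, DifferentiableAt ℝ (g i) z)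
    (l : En m) : gradL φ g l z = gradient φ z + ∑ i, l i • gradient (g i) z := by
  refine HasGradientAt.gradient ?_
  rw [hasGradientAt_iff_hasFDerivAt, map_add, map_sum]
  refine HasFDerivAt.add hφ.hasGradientAt.hasFDerivAt (HasFDerivAt.fun_sum fun i _ => ?_)
  rw [map_smul]
  exact (hg i).hasGradientAt.hasFDerivAt.const_mul (l i)

theorem eventually_gradL_eq (hφ : ContDiffAt ℝ 2 φ zs) (hg : ∀ i, ContDiffAt ℝ 2 (g i) zs) :
    ∀ᶠ z in 𝓝 zs, ∀ l : En m, gradL φ g l z = gradient φ z + ∑ i, l i • gradient (g i) z := by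
  filter_upwards [hφ.eventually_differentiableAt_of_two,
    eventually_all.2 fun i => (hg i).eventually_differentiableAt_of_two] with z h₁ h₂
  exact gradL_eq h₁ h₂

theorem hessL_apply (hφ : ContDiffAt ℝ 2 φ zs) (hg : ∀ i, ContDiffAt ℝ 2 (g i) zs) (l : En m)
    (w : En n) : hessL φ g l zs w = fderiv ℝ (gradient φ) zs w +
      ∑ i, l i • fderiv ℝ (gradient (g i)) zs w := by
  have h : HasFDerivAt (gradL φ g l) (fderiv ℝ (gradient φ) zs +
      ∑ i, l i • fderiv ℝ (gradient (g i)) zs) zs :=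
    (hφ.hasFDerivAt_gradient.add (HasFDerivAt.fun_sum fun i _ =>
      (hg i).hasFDerivAt_gradient.const_smul (l i))).congr_of_eventuallyEq
      ((eventually_gradL_eq hφ hg).mono fun _ hz => hz l)
  rw [hessL, h.fderiv]
  simp

/-- Difference quotients along a direction converge to the derivative. -/
theorem HasFDerivAt.tendsto_smul_sub {E E' ι : Type*} [NormedAddCommGroup E] [NormedSpace ℝ E]
    [NormedAddCommGroup E'] [NormedSpace ℝ E'] {f : E → E'} {f' : E →L[ℝ] E'} {x v : E}
    (h : HasFDerivAt f f' x) {F : Filter ι} {c : ι → ℝ} {y : ι → E} (hy : Tendsto y F (𝓝 x))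
    (hc : Tendsto (fun k => c k • (y k - x)) F (𝓝 v)) :
    Tendsto (fun k => c k • (f (y k) - f x)) F (𝓝 (f' v)) := by
  simpa using (hasFDerivWithinAt_univ.2 h).lim (d := fun k => y k - x)
    (by simpa using hy.sub_const x) (by simp) hc

end Linearization

section Multipliers

variable {n m : ℕ} {φ : En n → ℝ} {g : Fin m → En n → ℝ} {zs : En n}

theorem mem_Slam_iff (hφ : ContDiffAt ℝ 2 φ zs) (hg : ∀ i, ContDiffAt ℝ 2 (g i) zs) {l : En m} :
    l ∈ Slam φ g zs ↔ gradient φ zs + ∑ i, l i • gradient (g i) zs = 0 ∧ (∀ i, g i zs ≤ 0) ∧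
      (∀ i, 0 ≤ l i) ∧ ∀ i, l i * g i zs = 0 := by
  rw [← (eventually_gradL_eq hφ hg).self_of_nhds l]
  refine and_congr_right fun _ => and_congr_right fun h₁ => and_congr_right fun h₂ => ?_
  rw [Finset.sum_eq_zero_iff_of_nonpos fun i _ => mul_nonpos_of_nonneg_of_nonpos (h₂ i) (h₁ i)]
  simp

theorem isClosed_Slam (hφ : ContDiffAt ℝ 2 φ zs) (hg : ∀ i, ContDiffAt ℝ 2 (g i) zs) :
    IsClosed (Slam φ g zs) := by
  have : Slam φ g zs = {l : En m | gradient φ zs + ∑ i, l i • gradient (g i) zs = 0 ∧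
      (∀ i, g i zs ≤ 0) ∧ (∀ i, 0 ≤ l i) ∧ ∀ i, l i * g i zs = 0} :=
    Set.ext fun l => mem_Slam_iff hφ hg
  rw [this]
  refine (isClosed_eq (by fun_prop) (by fun_prop)).and (isClosed_const.and (IsClosed.and ?_ ?_))
  · simp only [Set.ofPred_forall]
    exact isClosed_iInter fun i => isClosed_le (by fun_prop) (by fun_prop)
  · simp only [Set.ofPred_forall]
    exact isClosed_iInter fun i => isClosed_eq (by fun_prop) (by fun_prop)

/-- A multiplier is orthogonal to the directional derivatives of the constraints up to the
directional derivative of the objective. -/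
theorem inner_gradient_of_mem_Slam (hφ : ContDiffAt ℝ 2 φ zs) (hg : ∀ i, ContDiffAt ℝ 2 (g i) zs)
    {l : En m} (hl : l ∈ Slam φ g zs) (w : En n) :
    ⟪gradient φ zs, w⟫ + ∑ i, l i * ⟪gradient (g i) zs, w⟫ = 0 := by
  simpa [inner_add_left, sum_inner, real_inner_smul_left] using
    congrArg (fun v => ⟪v, w⟫) ((mem_Slam_iff hφ hg).1 hl).1

theorem isCompact_Slam (hφ : ContDiffAt ℝ 2 φ zs) (hg : ∀ i, ContDiffAt ℝ 2 (g i) zs)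
    (hM : MFCQ g zs) : IsCompact (Slam φ g zs) := by
  obtain ⟨y, hy⟩ := hM
  refine Metric.isCompact_of_isClosed_isBounded (isClosed_Slam hφ hg) ?_
  have hbd : ∀ i, ∃ C : ℝ, ∀ l ∈ Slam φ g zs, |l i| ≤ C := by
    intro i
    by_cases hi : g i zs = 0
    · refine ⟨⟪gradient φ zs, y⟫ / -⟪gradient (g i) zs, y⟫, fun l hl => ?_⟩
      obtain ⟨-, -, h₀, hc⟩ := (mem_Slam_iff hφ hg).1 hl
      rw [abs_of_nonneg (h₀ i), le_div_iff₀ (neg_pos.2 (hy i hi))]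
      have hle : ∀ j, 0 ≤ l j * -⟪gradient (g j) zs, y⟫ := by
        intro j
        rcases mul_eq_zero.1 (hc j) with h | h
        · simp [h]
        · exact mul_nonneg (h₀ j) (neg_pos.2 (hy j h)).le
      have hs := Finset.single_le_sum (fun j _ => hle j) (Finset.mem_univ i)
      have he := inner_gradient_of_mem_Slam hφ hg hl y
      simp only [mul_neg, Finset.sum_neg_distrib] at hs
      linarith
    · refine ⟨0, fun l hl => ?_⟩
      have := (mul_eq_zero.1 (((mem_Slam_iff hφ hg).1 hl).2.2.2 i)).resolve_right hi
      simp [this]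
  choose C hC using hbd
  refine (Metric.isBounded_iff_subset_closedBall 0).2 ⟨√(∑ i, C i ^ 2), fun l hl => ?_⟩
  rw [mem_closedBall_zero_iff, EuclideanSpace.norm_eq]
  exact Real.sqrt_le_sqrt (Finset.sum_le_sum fun i _ =>
    pow_le_pow_left₀ (norm_nonneg _) (hC i l hl) 2)

/-- The displacement from the nearest multiplier makes an obtuse angle with every feasible
direction of the multiplier set. -/
theorem inner_sub_nearest_nonpos (hφ : ContDiffAt ℝ 2 φ zs) (hg : ∀ i, ContDiffAt ℝ 2 (g i) zs)
    {l p μ : En m} (hp : p ∈ Slam φ g zs) (hd : dist l p = infDist l (Slam φ g zs))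
    (hμ : ∑ i, μ i • gradient (g i) zs = 0) (hμB : ∀ i, g i zs ≠ 0 → μ i = 0)
    (hμ₀ : ∀ i, p i = 0 → 0 ≤ μ i) : ⟪l - p, μ⟫ ≤ 0 := by
  obtain ⟨h₁, h₂, h₃, h₄⟩ := (mem_Slam_iff hφ hg).1 hp
  have hev : ∀ᶠ t : ℝ in 𝓝[>] 0, ∀ i, 0 ≤ p i + t * μ i := by
    refine eventually_all.2 fun i => ?_
    rcases (h₃ i).eq_or_lt with h | h
    · filter_upwards [self_mem_nhdsWithin] with t ht
      rw [← h, zero_add]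
      exact mul_nonneg (le_of_lt ht) (hμ₀ i h.symm)
    · have hc : Tendsto (fun t : ℝ => p i + t * μ i) (𝓝 0) (𝓝 (p i + 0 * μ i)) :=
        Continuous.tendsto (by fun_prop) 0
      rw [zero_mul, add_zero] at hc
      exact ((hc.eventually_const_lt h).filter_mono nhdsWithin_le_nhds).mono fun _ ht => ht.le
  have hle : ∀ᶠ t : ℝ in 𝓝[>] 0, 2 * ⟪l - p, μ⟫ ≤ t * ‖μ‖ ^ 2 := by
    filter_upwards [hev, self_mem_nhdsWithin] with t ht ht₀
    have hmem : p + t • μ ∈ Slam φ g zs := by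
      refine (mem_Slam_iff hφ hg).2 ⟨?_, h₂, by simpa using ht, fun i => ?_⟩
      · simp only [PiLp.add_apply, PiLp.smul_apply, smul_eq_mul, add_smul, mul_smul,
          Finset.sum_add_distrib, ← Finset.smul_sum, hμ, smul_zero, add_zero, h₁]
      · by_cases hi : g i zs = 0
        · simp [hi]
        · simp [hμB i hi, h₄ i]
    have h := infDist_le_dist_of_mem (x := l) hmem
    rw [← hd, dist_eq_norm, dist_eq_norm, ← sub_sub] at h
    have h' := pow_le_pow_left₀ (norm_nonneg _) h 2
    rw [norm_sub_sq_real (l - p), real_inner_smul_right, norm_smul, mul_pow, Real.norm_eq_abs,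
      sq_abs] at h'
    have ht₁ : 0 < t := ht₀
    refine le_of_mul_le_mul_left ?_ ht₁
    linarith
  have hlim : Tendsto (fun t : ℝ => t * ‖μ‖ ^ 2) (𝓝[>] 0) (𝓝 (0 * ‖μ‖ ^ 2)) :=
    (Continuous.tendsto (by fun_prop) 0).mono_left nhdsWithin_le_nhds
  have := ge_of_tendsto hlim hle
  linarith

theorem min_eq_zero_of_mem_Slam (hφ : ContDiffAt ℝ 2 φ zs) (hg : ∀ i, ContDiffAt ℝ 2 (g i) zs)
    {l : En m} (hl : l ∈ Slam φ g zs) (i : Fin m) : min (l i) (-g i zs) = 0 := by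
  obtain ⟨-, h₁, h₀, hc⟩ := (mem_Slam_iff hφ hg).1 hl
  rcases mul_eq_zero.1 (hc i) with h | h
  · rw [h, min_eq_left (neg_nonneg.2 (h₁ i))]
  · rw [h, neg_zero, min_eq_right (h₀ i)]

theorem eq_zero_of_mem_Slam_of_notMem_Bplus (hφ : ContDiffAt ℝ 2 φ zs)
    (hg : ∀ i, ContDiffAt ℝ 2 (g i) zs) {i : Fin m} (hi : i ∉ Bplus φ g zs) {l : En m}
    (hl : l ∈ Slam φ g zs) : l i = 0 := by
  obtain ⟨-, -, h₀, hc⟩ := (mem_Slam_iff hφ hg).1 hl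
  by_contra hne
  exact hi ⟨(mul_eq_zero.1 (hc i)).resolve_left hne, l, hl, (h₀ i).lt_of_ne' hne⟩

end Multipliers

/-- A blow-up of primal-dual points `(z, l)` converging to the solution set: `p` are nearest
multipliers, `t` are the distances, and `(w, μ)` is the limit of the normalized displacements. -/
structure IsBlowUp {n m : ℕ} (φ : En n → ℝ) (g : Fin m → En n → ℝ) (zs : En n) {ι : Type*}
    (F : Filter ι) (t : ι → ℝ) (z : ι → En n) (l p : ι → En m) (w : En n) (μ ls : En m) :
    Prop where
  pos : ∀ k, 0 < t k
  nearest_mem : ∀ k, p k ∈ Slam φ g zs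
  dist_nearest : ∀ k, dist (l k) (p k) = infDist (l k) (Slam φ g zs)
  limit_mem : ls ∈ Slam φ g zs
  tendsto_primal : Tendsto z F (𝓝 zs)
  tendsto_dual : Tendsto l F (𝓝 ls)
  primal_direction : Tendsto (fun k => (t k)⁻¹ • (z k - zs)) F (𝓝 w)
  dual_direction : Tendsto (fun k => (t k)⁻¹ • (l k - p k)) F (𝓝 μ)
  norm_sq_direction : ‖w‖ ^ 2 + ‖μ‖ ^ 2 = 1

theorem Ultrafilter.exists_tendsto_of_mem_isCompact {X ι : Type*} [TopologicalSpace X]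
    {s : Set X} (hs : IsCompact s) (F : Ultrafilter ι) {u : ι → X} (hu : ∀ k, u k ∈ s) :
    ∃ x ∈ s, Tendsto u F (𝓝 x) :=
  hs.ultrafilter_le_nhds' (F.map u) (Eventually.of_forall (f := (F : Filter ι)) hu)

section BlowUp

variable {n m : ℕ} {φ : En n → ℝ} {g : Fin m → En n → ℝ} {zs : En n} {ι : Type*}

theorem deltaP_sq (z : En n) (l : En m) :
    deltaP φ g zs z l ^ 2 = ‖z - zs‖ ^ 2 + infDist l (Slam φ g zs) ^ 2 :=
  Real.sq_sqrt (by positivity)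

theorem eta_sq (z : En n) (l : En m) :
    eta φ g z l ^ 2 = ‖gradL φ g l z‖ ^ 2 + ∑ i, (min (l i) (-(g i z))) ^ 2 :=
  Real.sq_sqrt (by positivity)

theorem norm_gradL_le_eta (z : En n) (l : En m) : ‖gradL φ g l z‖ ≤ eta φ g z l :=
  Real.le_sqrt_of_sq_le (le_add_of_nonneg_right (Finset.sum_nonneg fun _ _ => sq_nonneg _))

theorem abs_min_le_eta (z : En n) (l : En m) (i : Fin m) :
    |min (l i) (-g i z)| ≤ eta φ g z l := by
  refine Real.abs_le_sqrt (le_trans ?_ (le_add_of_nonneg_left (sq_nonneg _)))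
  exact Finset.single_le_sum (f := fun j => min (l j) (-g j z) ^ 2) (fun _ _ => sq_nonneg _)
    (Finset.mem_univ i)

theorem eta_le_sqrt_mul {z : En n} {l : En m} {t C : ℝ} (ht : 0 < t)
    (h : t⁻¹ ^ 2 * eta φ g z l ^ 2 ≤ C) : eta φ g z l ≤ √C * t := by
  rw [← div_le_iff₀ ht]
  exact Real.le_sqrt_of_sq_le (by rwa [div_eq_inv_mul, mul_pow])

theorem eta_eq_zero_of_deltaP_eq_zero (hφ : ContDiffAt ℝ 2 φ zs)
    (hg : ∀ i, ContDiffAt ℝ 2 (g i) zs) (hne : (Slam φ g zs).Nonempty) {z : En n} {l : En m}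
    (h : deltaP φ g zs z l = 0) : eta φ g z l = 0 := by
  have hsq := deltaP_sq (φ := φ) (g := g) (zs := zs) z l
  rw [h, zero_pow two_ne_zero, eq_comm, add_eq_zero_iff_of_nonneg (sq_nonneg _) (sq_nonneg _),
    sq_eq_zero_iff, sq_eq_zero_iff, norm_eq_zero, sub_eq_zero] at hsq
  obtain ⟨rfl, hd⟩ := hsq
  have hl : l ∈ Slam φ g z := ((isClosed_Slam hφ hg).mem_iff_infDist_zero hne).2 hd
  have hgrad : gradL φ g l z = 0 := hl.1
  simp [eta, hgrad, min_eq_zero_of_mem_Slam hφ hg hl]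

theorem exists_isBlowUp (hφ : ContDiffAt ℝ 2 φ zs) (hg : ∀ i, ContDiffAt ℝ 2 (g i) zs)
    (hne : (Slam φ g zs).Nonempty) (hM : MFCQ g zs) (F : Ultrafilter ι) {z : ι → En n}
    {l : ι → En m} (hpos : ∀ k, 0 < deltaP φ g zs (z k) (l k))
    (hlim : Tendsto (fun k => deltaP φ g zs (z k) (l k)) F (𝓝 0)) :
    ∃ p w μ ls, IsBlowUp φ g zs F (fun k => deltaP φ g zs (z k) (l k)) z l p w μ ls := by
  choose p hpS hpd using fun k => (isClosed_Slam hφ hg).exists_infDist_eq_dist hne (l k)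
  obtain ⟨ls, hls, hpls⟩ := F.exists_tendsto_of_mem_isCompact (isCompact_Slam hφ hg hM) hpS
  set t := fun k => deltaP φ g zs (z k) (l k) with ht
  have hsq : ∀ k, t k ^ 2 = ‖z k - zs‖ ^ 2 + ‖l k - p k‖ ^ 2 := by
    intro k
    rw [ht, ← dist_eq_norm (l k), ← hpd k]
    exact deltaP_sq _ _
  have hz : ∀ k, ‖z k - zs‖ ≤ t k := fun k =>
    pow_le_pow_iff_left₀ (norm_nonneg _) (hpos k).le two_ne_zero |>.1 (by
      have := hsq k; nlinarith [sq_nonneg ‖l k - p k‖])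
  have hl : ∀ k, ‖l k - p k‖ ≤ t k := fun k =>
    pow_le_pow_iff_left₀ (norm_nonneg _) (hpos k).le two_ne_zero |>.1 (by
      have := hsq k; nlinarith [sq_nonneg ‖z k - zs‖])
  obtain ⟨w, -, hw⟩ := F.exists_tendsto_of_mem_isCompact (isCompact_closedBall (0 : En n) 1)
    (u := fun k => (t k)⁻¹ • (z k - zs)) fun k => by
      rw [mem_closedBall_zero_iff, norm_smul, norm_inv, Real.norm_of_nonneg (hpos k).le,
        inv_mul_le_iff₀ (hpos k), mul_one]
      exact hz k
  obtain ⟨μ, -, hμ⟩ := F.exists_tendsto_of_mem_isCompact (isCompact_closedBall (0 : En m) 1)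
    (u := fun k => (t k)⁻¹ • (l k - p k)) fun k => by
      rw [mem_closedBall_zero_iff, norm_smul, norm_inv, Real.norm_of_nonneg (hpos k).le,
        inv_mul_le_iff₀ (hpos k), mul_one]
      exact hl k
  refine ⟨p, w, μ, ls, hpos, hpS, fun k => (hpd k).symm, hls, ?_, ?_, hw, hμ, ?_⟩
  · exact tendsto_iff_norm_sub_tendsto_zero.2
      (squeeze_zero (fun _ => norm_nonneg _) hz hlim)
  · have : Tendsto (fun k => l k - p k) F (𝓝 0) := squeeze_zero_norm hl hlim
    simpa using this.add hpls
  · refine tendsto_nhds_unique ((hw.norm.pow 2).add (hμ.norm.pow 2)) ?_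
    refine tendsto_const_nhds.congr fun k => ?_
    have : t k ≠ 0 := (hpos k).ne'
    rw [norm_smul, norm_smul, norm_inv, Real.norm_of_nonneg (hpos k).le, mul_pow, mul_pow,
      ← mul_add, ← hsq k, ← mul_pow, inv_mul_cancel₀ this, one_pow]

namespace IsBlowUp

variable {F : Filter ι} {t : ι → ℝ} {z : ι → En n} {l p : ι → En m} {w : En n} {μ ls : En m}

theorem tendsto_coord (h : IsBlowUp φ g zs F t z l p w μ ls) (i : Fin m) :
    Tendsto (fun k => l k i) F (𝓝 (ls i)) :=
  (Continuous.tendsto (by fun_prop : Continuous fun v : En m => v i) ls).comp h.tendsto_dual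

theorem dual_direction_coord (h : IsBlowUp φ g zs F t z l p w μ ls) (i : Fin m) :
    Tendsto (fun k => (t k)⁻¹ * (l k i - p k i)) F (𝓝 (μ i)) := by
  simpa [Function.comp_def] using
    (Continuous.tendsto (by fun_prop : Continuous fun v : En m => v i) μ).comp h.dual_direction

theorem tendsto_constraint (h : IsBlowUp φ g zs F t z l p w μ ls)
    (hg : ∀ i, ContDiffAt ℝ 2 (g i) zs) (i : Fin m) :
    Tendsto (fun k => (t k)⁻¹ * (g i (z k) - g i zs)) F (𝓝 ⟪gradient (g i) zs, w⟫) := by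
  rw [inner_gradient_left]
  exact ((hg i).differentiableAt (by norm_num)).hasFDerivAt.tendsto_smul_sub
    h.tendsto_primal h.primal_direction

theorem tendsto_gradL (h : IsBlowUp φ g zs F t z l p w μ ls) (hφ : ContDiffAt ℝ 2 φ zs)
    (hg : ∀ i, ContDiffAt ℝ 2 (g i) zs) :
    Tendsto (fun k => (t k)⁻¹ • gradL φ g (l k) (z k)) F
      (𝓝 (hessL φ g ls zs w + ∑ i, μ i • gradient (g i) zs)) := by
  rw [hessL_apply hφ hg]
  have h₁ := hφ.hasFDerivAt_gradient.tendsto_smul_sub h.tendsto_primal h.primal_direction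
  have h₂ := fun i => (hg i).hasFDerivAt_gradient.tendsto_smul_sub h.tendsto_primal
    h.primal_direction
  refine ((h₁.add (tendsto_finsetSum Finset.univ fun i _ => (h.tendsto_coord i).smul (h₂ i))).add
    (tendsto_finsetSum Finset.univ fun i _ =>
      (h.dual_direction_coord i).smul_const (gradient (g i) zs))).congr' ?_
  filter_upwards [h.tendsto_primal.eventually (eventually_gradL_eq hφ hg)] with k hk
  have hp := ((mem_Slam_iff hφ hg).1 (h.nearest_mem k)).1
  rw [hk, ← sub_zero (gradient φ (z k) + _), ← hp]
  simp only [smul_sub, smul_add, Finset.smul_sum, sub_smul, mul_sub, mul_smul,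
    Finset.sum_sub_distrib, smul_comm (l _ _) ((t k)⁻¹)]
  abel

theorem tendsto_constraint_of_active (h : IsBlowUp φ g zs F t z l p w μ ls)
    (hg : ∀ i, ContDiffAt ℝ 2 (g i) zs) {i : Fin m} (hi : g i zs = 0) :
    Tendsto (fun k => (t k)⁻¹ * g i (z k)) F (𝓝 ⟪gradient (g i) zs, w⟫) := by
  simpa [hi] using h.tendsto_constraint hg i

theorem tendsto_constraint_value (h : IsBlowUp φ g zs F t z l p w μ ls)
    (hg : ∀ i, ContDiffAt ℝ 2 (g i) zs) (i : Fin m) :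
    Tendsto (fun k => g i (z k)) F (𝓝 (g i zs)) :=
  (hg i).continuousAt.tendsto.comp h.tendsto_primal

section Residual

variable [F.NeBot]

theorem inner_gradient_nonpos (h : IsBlowUp φ g zs F t z l p w μ ls)
    (hg : ∀ i, ContDiffAt ℝ 2 (g i) zs) {i : Fin m} (hi : g i zs = 0)
    (hmin : Tendsto (fun k => (t k)⁻¹ * min (l k i) (-g i (z k))) F (𝓝 0)) :
    ⟪gradient (g i) zs, w⟫ ≤ 0 := by
  have hle := le_of_tendsto_of_tendsto' hmin (h.tendsto_constraint_of_active hg hi).neg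
    fun k => by
      rw [← mul_neg]
      exact mul_le_mul_of_nonneg_left (min_le_right _ _) (inv_pos.2 (h.pos k)).le
  linarith

theorem inner_gradient_eq_zero_of_pos (h : IsBlowUp φ g zs F t z l p w μ ls)
    (hg : ∀ i, ContDiffAt ℝ 2 (g i) zs) {i : Fin m} (hi : g i zs = 0) (hls : 0 < ls i)
    (hmin : Tendsto (fun k => (t k)⁻¹ * min (l k i) (-g i (z k))) F (𝓝 0)) :
    ⟪gradient (g i) zs, w⟫ = 0 := by
  have hv := (h.tendsto_constraint_value hg i).neg
  rw [hi, neg_zero] at hv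
  have heq := tendsto_nhds_unique (hmin.congr' (by
    filter_upwards [hv.eventually_lt (h.tendsto_coord i) hls] with k hk
    rw [min_eq_right hk.le, mul_neg])) (h.tendsto_constraint_of_active hg hi).neg
  linarith

/-- The primal direction of a blow-up with vanishing residual is critical. -/
theorem inner_gradient_eq_zero_of_mem_Bplus (h : IsBlowUp φ g zs F t z l p w μ ls)
    (hφ : ContDiffAt ℝ 2 φ zs) (hg : ∀ i, ContDiffAt ℝ 2 (g i) zs)
    (hmin : ∀ i, Tendsto (fun k => (t k)⁻¹ * min (l k i) (-g i (z k))) F (𝓝 0))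
    {i : Fin m} (hi : i ∈ Bplus φ g zs) : ⟪gradient (g i) zs, w⟫ = 0 := by
  obtain ⟨hgi, v, hv, hvi⟩ := hi
  obtain ⟨-, -, h₀, hc⟩ := (mem_Slam_iff hφ hg).1 h.limit_mem
  have hobj := inner_gradient_of_mem_Slam hφ hg h.limit_mem w
  rw [Finset.sum_eq_zero, add_zero] at hobj
  · have hsum := inner_gradient_of_mem_Slam hφ hg hv w
    obtain ⟨-, -, hv₀, hvc⟩ := (mem_Slam_iff hφ hg).1 hv
    rw [hobj, zero_add, Finset.sum_eq_zero_iff_of_nonpos] at hsum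
    · exact (mul_eq_zero.1 (hsum i (Finset.mem_univ i))).resolve_left hvi.ne'
    · intro j _
      rcases mul_eq_zero.1 (hvc j) with hj | hj
      · simp [hj]
      · exact mul_nonpos_of_nonneg_of_nonpos (hv₀ j) (h.inner_gradient_nonpos hg hj (hmin j))
  · intro j _
    rcases (h₀ j).eq_or_lt with hj | hj
    · simp [← hj]
    · rw [h.inner_gradient_eq_zero_of_pos hg ((mul_eq_zero.1 (hc j)).resolve_left hj.ne') hj
        (hmin j), mul_zero]

theorem dual_direction_eq_zero_of_inactive (h : IsBlowUp φ g zs F t z l p w μ ls)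
    (hφ : ContDiffAt ℝ 2 φ zs) (hg : ∀ i, ContDiffAt ℝ 2 (g i) zs) {i : Fin m} (hi : g i zs ≠ 0)
    (hmin : Tendsto (fun k => (t k)⁻¹ * min (l k i) (-g i (z k))) F (𝓝 0)) : μ i = 0 := by
  have hB : i ∉ Bplus φ g zs := fun hB => hi hB.1
  have hls := eq_zero_of_mem_Slam_of_notMem_Bplus hφ hg hB h.limit_mem
  have hlt : ls i < -g i zs := by
    rw [hls]
    exact neg_pos.2 ((((mem_Slam_iff hφ hg).1 h.limit_mem).2.1 i).lt_of_ne hi)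
  refine (tendsto_nhds_unique (hmin.congr' ?_) (h.dual_direction_coord i)).symm
  filter_upwards [(h.tendsto_coord i).eventually_lt (h.tendsto_constraint_value hg i).neg hlt]
    with k hk
  rw [min_eq_left hk.le,
    eq_zero_of_mem_Slam_of_notMem_Bplus hφ hg hB (h.nearest_mem k), sub_zero]

theorem dual_direction_eq_zero_of_inner_gradient_neg (h : IsBlowUp φ g zs F t z l p w μ ls)
    (hφ : ContDiffAt ℝ 2 φ zs) (hg : ∀ i, ContDiffAt ℝ 2 (g i) zs) {i : Fin m}
    (hi : g i zs = 0) (hneg : ⟪gradient (g i) zs, w⟫ < 0) (hB : i ∉ Bplus φ g zs)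
    (hmin : Tendsto (fun k => (t k)⁻¹ * min (l k i) (-g i (z k))) F (𝓝 0)) : μ i = 0 := by
  have heq := tendsto_nhds_unique (hmin.congr fun k => show _ =
      min ((t k)⁻¹ * (l k i - p k i)) (-((t k)⁻¹ * g i (z k))) by
    rw [mul_min_of_nonneg _ _ (inv_pos.2 (h.pos k)).le, mul_neg,
      eq_zero_of_mem_Slam_of_notMem_Bplus hφ hg hB (h.nearest_mem k), sub_zero])
    ((h.dual_direction_coord i).min (h.tendsto_constraint_of_active hg hi).neg)
  rcases min_choice (μ i) (-⟪gradient (g i) zs, w⟫) with hm | hm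
  · exact hm ▸ heq.symm
  · rw [hm] at heq
    linarith

theorem dual_direction_nonneg (h : IsBlowUp φ g zs F t z l p w μ ls) {i : Fin m}
    (hp : ∀ᶠ k in F, p k i = 0)
    (hmin : Tendsto (fun k => (t k)⁻¹ * min (l k i) (-g i (z k))) F (𝓝 0)) : 0 ≤ μ i := by
  refine le_of_tendsto_of_tendsto hmin (h.dual_direction_coord i) ?_
  filter_upwards [hp] with k hk
  rw [hk, sub_zero]
  exact mul_le_mul_of_nonneg_left (min_le_left _ _) (inv_pos.2 (h.pos k)).le

theorem primal_direction_eq_zero (h : IsBlowUp φ g zs F t z l p w μ ls)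
    (hφ : ContDiffAt ℝ 2 φ zs) (hg : ∀ i, ContDiffAt ℝ 2 (g i) zs) (hS : SOC φ g zs)
    (hgrad : Tendsto (fun k => (t k)⁻¹ • gradL φ g (l k) (z k)) F (𝓝 0))
    (hmin : ∀ i, Tendsto (fun k => (t k)⁻¹ * min (l k i) (-g i (z k))) F (𝓝 0)) : w = 0 := by
  obtain ⟨σ, hσ, hS⟩ := hS
  have hpos := hS ls h.limit_mem w
    (fun i hi => h.inner_gradient_eq_zero_of_mem_Bplus hφ hg hmin hi)
    (fun i hi => h.inner_gradient_nonpos hg hi.1 (hmin i))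
  have hzero : ∀ i, μ i * ⟪w, gradient (g i) zs⟫ = 0 := by
    intro i
    rw [real_inner_comm]
    by_cases hi : g i zs = 0
    · by_cases hB : i ∈ Bplus φ g zs
      · rw [h.inner_gradient_eq_zero_of_mem_Bplus hφ hg hmin hB, mul_zero]
      · rcases (h.inner_gradient_nonpos hg hi (hmin i)).eq_or_lt with hw | hw
        · rw [hw, mul_zero]
        · rw [h.dual_direction_eq_zero_of_inner_gradient_neg hφ hg hi hw hB (hmin i), zero_mul]
    · rw [h.dual_direction_eq_zero_of_inactive hφ hg hi (hmin i), zero_mul]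
  have hlim := congrArg (fun v => ⟪w, v⟫) (tendsto_nhds_unique (h.tendsto_gradL hφ hg) hgrad)
  simp only [inner_add_right, inner_sum, real_inner_smul_right, hzero, Finset.sum_const_zero,
    add_zero, inner_zero_right] at hlim
  rw [hlim] at hpos
  have : ‖w‖ ^ 2 ≤ 0 := by
    by_contra! hw
    exact absurd hpos (not_le.2 (mul_pos hσ hw))
  simpa using this

end Residual

/-- Under the second-order condition the residual of a blow-up cannot vanish to first order. -/
theorem not_tendsto_residual {F : Ultrafilter ι} (h : IsBlowUp φ g zs F t z l p w μ ls)
    (hφ : ContDiffAt ℝ 2 φ zs) (hg : ∀ i, ContDiffAt ℝ 2 (g i) zs) (hS : SOC φ g zs)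
    (hgrad : Tendsto (fun k => (t k)⁻¹ • gradL φ g (l k) (z k)) F (𝓝 0))
    (hmin : ∀ i, Tendsto (fun k => (t k)⁻¹ * min (l k i) (-g i (z k))) F (𝓝 0)) : False := by
  have hw := h.primal_direction_eq_zero hφ hg hS hgrad hmin
  have hμ : ∑ i, μ i • gradient (g i) zs = 0 := by
    simpa [hw] using tendsto_nhds_unique (h.tendsto_gradL hφ hg) hgrad
  have hev : ∀ᶠ k in (F : Filter ι), ∀ i, p k i = 0 → 0 ≤ μ i := by
    refine eventually_all.2 fun i => ?_
    rcases F.em fun k => p k i = 0 with hp | hp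
    · exact Eventually.of_forall fun _ _ => h.dual_direction_nonneg hp (hmin i)
    · exact hp.mono fun k hk h0 => absurd h0 hk
  have hle : ⟪μ, μ⟫ ≤ 0 := by
    refine le_of_tendsto (h.dual_direction.inner tendsto_const_nhds) ?_
    filter_upwards [hev] with k hk
    rw [real_inner_smul_left]
    exact mul_nonpos_of_nonneg_of_nonpos (inv_pos.2 (h.pos k)).le
      (inner_sub_nearest_nonpos hφ hg (h.nearest_mem k) (h.dist_nearest k) hμ
        (fun i hi => h.dual_direction_eq_zero_of_inactive hφ hg hi (hmin i)) hk)
  have hnorm := h.norm_sq_direction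
  rw [real_inner_self_eq_norm_sq] at hle
  rw [hw, norm_zero] at hnorm
  linarith

/-- The residual of a blow-up is of at most first order. -/
theorem exists_eventually_eta_le [F.NeBot] (h : IsBlowUp φ g zs F t z l p w μ ls)
    (hφ : ContDiffAt ℝ 2 φ zs) (hg : ∀ i, ContDiffAt ℝ 2 (g i) zs) :
    ∃ C : ℝ, ∀ᶠ k in F, eta φ g (z k) (l k) ≤ C * t k := by
  have hlim := ((h.tendsto_gradL hφ hg).norm.pow 2).add (tendsto_finsetSum Finset.univ
    fun i _ => ((h.dual_direction_coord i).abs.max (h.tendsto_constraint hg i).abs).pow 2)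
  refine ⟨_, (hlim.eventually_le_const (lt_add_one _)).mono fun k hk =>
    (eta_le_sqrt_mul (h.pos k) (le_trans ?_ hk))⟩
  rw [norm_smul, mul_pow, norm_inv, Real.norm_of_nonneg (h.pos k).le, eta_sq, mul_add,
    Finset.mul_sum]
  gcongr with i
  rw [← mul_pow, ← sq_abs, abs_mul, abs_mul, abs_mul, ← mul_max_of_nonneg _ _ (abs_nonneg _)]
  gcongr
  have hm := abs_min_sub_min_le_max (l k i) (-g i (z k)) (p k i) (-g i zs)
  rwa [min_eq_zero_of_mem_Slam hφ hg (h.nearest_mem k), sub_zero, ← neg_sub', abs_neg] at hm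

end IsBlowUp

theorem exists_mul_deltaP_le_eta (hφ : ContDiffAt ℝ 2 φ zs) (hg : ∀ i, ContDiffAt ℝ 2 (g i) zs)
    (hne : (Slam φ g zs).Nonempty) (hM : MFCQ g zs) (hS : SOC φ g zs) :
    ∃ δ : ℝ, 0 < δ ∧ ∃ κ : ℝ, 0 < κ ∧ ∀ (z : En n) (l : En m), deltaP φ g zs z l ≤ δ →
      κ * deltaP φ g zs z l ≤ eta φ g z l := by
  by_contra! hcon
  have hpos : ∀ k : ℕ, (0 : ℝ) < 1 / (k + 1) := fun k => Nat.one_div_pos_of_nat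
  choose z l hδ hη using fun k : ℕ => hcon _ (hpos k) _ (hpos k)
  have ht : ∀ k, 0 < deltaP φ g zs (z k) (l k) := fun k =>
    pos_of_mul_pos_right ((Real.sqrt_nonneg _).trans_lt (hη k)) (hpos k).le
  have h₀ : Tendsto (fun k : ℕ => 1 / ((k : ℝ) + 1)) (hyperfilter ℕ) (𝓝 0) :=
    tendsto_one_div_add_atTop_nhds_zero_nat.mono_left Nat.hyperfilter_le_atTop
  obtain ⟨p, w, μ, ls, h⟩ := exists_isBlowUp hφ hg hne hM (hyperfilter ℕ) ht
    (squeeze_zero (fun k => (ht k).le) hδ h₀)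
  have hle : ∀ k, (deltaP φ g zs (z k) (l k))⁻¹ * eta φ g (z k) (l k) ≤ 1 / ((k : ℝ) + 1) := by
    intro k
    rw [inv_mul_le_iff₀ (ht k), mul_comm]
    exact (hη k).le
  refine h.not_tendsto_residual hφ hg hS (squeeze_zero_norm (fun k => le_trans ?_ (hle k)) h₀)
    fun i => squeeze_zero_norm (fun k => le_trans ?_ (hle k)) h₀
  · rw [norm_smul, norm_inv, Real.norm_of_nonneg (ht k).le]
    exact mul_le_mul_of_nonneg_left (norm_gradL_le_eta _ _) (inv_pos.2 (ht k)).le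
  · rw [norm_mul, norm_inv, Real.norm_of_nonneg (ht k).le]
    exact mul_le_mul_of_nonneg_left (abs_min_le_eta _ _ i) (inv_pos.2 (ht k)).le

theorem exists_eta_le_mul_deltaP (hφ : ContDiffAt ℝ 2 φ zs) (hg : ∀ i, ContDiffAt ℝ 2 (g i) zs)
    (hne : (Slam φ g zs).Nonempty) (hM : MFCQ g zs) :
    ∃ δ : ℝ, 0 < δ ∧ ∃ κ : ℝ, 0 < κ ∧ ∀ (z : En n) (l : En m), deltaP φ g zs z l ≤ δ →
      eta φ g z l ≤ κ * deltaP φ g zs z l := by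
  by_contra! hcon
  choose z l hδ hη using fun k : ℕ =>
    hcon (1 / ((k : ℝ) + 1)) Nat.one_div_pos_of_nat (k + 1) k.cast_add_one_pos
  have ht : ∀ k, 0 < deltaP φ g zs (z k) (l k) := by
    refine fun k => (Real.sqrt_nonneg _).lt_of_ne' fun h => (hη k).ne ?_
    rw [eta_eq_zero_of_deltaP_eq_zero hφ hg hne h]
    exact mul_eq_zero_of_right _ h
  have h₀ : Tendsto (fun k : ℕ => 1 / ((k : ℝ) + 1)) (hyperfilter ℕ) (𝓝 0) :=
    tendsto_one_div_add_atTop_nhds_zero_nat.mono_left Nat.hyperfilter_le_atTop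
  obtain ⟨p, w, μ, ls, h⟩ := exists_isBlowUp hφ hg hne hM (hyperfilter ℕ) ht
    (squeeze_zero (fun k => (ht k).le) hδ h₀)
  obtain ⟨C, hC⟩ := h.exists_eventually_eta_le hφ hg
  have hlarge : ∀ᶠ k : ℕ in hyperfilter ℕ, C ≤ k :=
    Nat.hyperfilter_le_atTop (tendsto_natCast_atTop_atTop.eventually_ge_atTop C)
  obtain ⟨k, hk, hCk⟩ := (hC.and hlarge).exists
  have := lt_of_mul_lt_mul_right ((hη k).trans_le hk) (ht k).le
  linarith

end BlowUp

end ErrorBound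

/-- Theorem 2.2: η(z,λ) is equivalent to the distance δ(z,λ) to the primal-dual optimal set. -/
theorem stmt_1 {n m : ℕ} (φ : En n → ℝ) (g : Fin m → En n → ℝ) (zs : En n)
    (hA : AssumpA φ g zs) :
    ∃ δ : ℝ, 0 < δ ∧ ∃ κ₀ : ℝ, 0 < κ₀ ∧ ∃ κ₁ : ℝ, 0 < κ₁ ∧
      ∀ (z : En n) (l : En m), deltaP φ g zs z l ≤ δ →
        κ₀ * deltaP φ g zs z l ≤ eta φ g z l ∧
        eta φ g z l ≤ κ₁ * deltaP φ g zs z l := by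
  obtain ⟨⟨U, hU, hφU, hgU, -⟩, hne, hM, hS⟩ := hA
  have hφ := hφU.contDiffAt hU
  have hg := fun i => (hgU i).contDiffAt hU
  obtain ⟨δ₀, hδ₀, κ₀, hκ₀, h₀⟩ := exists_mul_deltaP_le_eta hφ hg hne hM hS
  obtain ⟨δ₁, hδ₁, κ₁, hκ₁, h₁⟩ := exists_eta_le_mul_deltaP hφ hg hne hM
  exact ⟨min δ₀ δ₁, lt_min hδ₀ hδ₁, κ₀, hκ₀, κ₁, hκ₁, fun z l h =>
    ⟨h₀ z l (h.trans (min_le_left _ _)), h₁ z l (h.trans (min_le_right _ _))⟩⟩
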